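/- arXiv:1306.0329 — 2 statements merged into one kernel-verified Lean document; each statement's English description precedes it below -/
import Mathlib

section
/- (Time derivative estimate for the scheme) Assume (A1) and that m⁰ is finite. If (U^{α,n}_i) solves the scheme (NS) and the CFL condition (CFL′) holds, then with m^n = inf{W^{α,n}_i : α, i} and M^n = sup{W^{α,n}_i : α, i}, one has for every n ≥ 0: m⁰ ≤ m^n ≤ m^{n+1} ≤ M^{n+1} ≤ M^n ≤ M⁰. -/
open Set Filter

/-- Assumption (A1) for a single Hamiltonian: `H` is `C¹`, coercive
(`H p → +∞` as `|p| → +∞`), non-increasing on `(-∞, p₀]` and non-decreasing on `[p₀, +∞)`. -/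
def A1cond (H : ℝ → ℝ) (p₀ : ℝ) : Prop :=
  ContDiff ℝ 1 H ∧ Tendsto H (cocompact ℝ) atTop ∧
    AntitoneOn H (Iic p₀) ∧ MonotoneOn H (Ici p₀)

/-- The non-increasing envelope `H⁻` of `H` with turning point `p₀`. -/
noncomputable def Hm (H : ℝ → ℝ) (p₀ : ℝ) (p : ℝ) : ℝ :=
  if p ≤ p₀ then H p else H p₀

/-- The non-decreasing envelope `H⁺` of `H` with turning point `p₀`. -/
noncomputable def Hp (H : ℝ → ℝ) (p₀ : ℝ) (p : ℝ) : ℝ :=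
  if p ≤ p₀ then H p₀ else H p

/-- One time step of the numerical scheme (NS) on the junction:
`V` (the values at time `n+1`) is computed from `U` (the values at time `n`).
For `i ≥ 1` on each branch `α` the update uses
`max (H⁺_α(p_{i,-}), H⁻_α(p_{i,+}))`; at the junction point `i = 0` all branches share a
common value and the update uses `max_β H⁻_β(p^β_{0,+})`. -/
def SchemeStep {N : ℕ} (H : Fin N → ℝ → ℝ) (p₀ : Fin N → ℝ) (Δx Δt : ℝ)
    (U V : Fin N → ℕ → ℝ) : Prop :=
  (∀ (α : Fin N) (i : ℕ), 1 ≤ i →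
      V α i = U α i - Δt * max (Hp (H α) (p₀ α) ((U α i - U α (i - 1)) / Δx))
        (Hm (H α) (p₀ α) ((U α (i + 1) - U α i) / Δx))) ∧
  (∀ α β : Fin N, U α 0 = U β 0) ∧
  (∀ α : Fin N, V α 0 = U α 0 - Δt *
      sSup (Set.range fun β : Fin N => Hm (H β) (p₀ β) ((U β 1 - U β 0) / Δx)))

/-- The numerical scheme (NS): `U α n i` is the value on branch `α` at time step `n`
and grid point `i`. -/
def SchemeNS {N : ℕ} (H : Fin N → ℝ → ℝ) (p₀ : Fin N → ℝ) (Δx Δt : ℝ)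
    (U : Fin N → ℕ → ℕ → ℝ) : Prop :=
  ∀ n : ℕ, SchemeStep H p₀ Δx Δt (fun α i => U α n i) (fun α i => U α (n + 1) i)

theorem Hp_eq_max (H : ℝ → ℝ) (p₀ p : ℝ) : Hp H p₀ p = H (max p p₀) := by
  unfold Hp
  split_ifs with h
  · rw [max_eq_right h]
  · rw [max_eq_left (not_le.1 h).le]

theorem Hm_neg_eq_Hp (H : ℝ → ℝ) (p₀ p : ℝ) :
    Hm H p₀ (-p) = Hp (fun x => H (-x)) (-p₀) p := by
  rw [Hp_eq_max, ← min_neg_neg, neg_neg]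
  unfold Hm
  split_ifs with h
  · rw [min_eq_left h]
  · rw [min_eq_right (not_le.1 h).le]

theorem A1cond.neg {H : ℝ → ℝ} {p₀ : ℝ} (h : A1cond H p₀) :
    A1cond (fun x => H (-x)) (-p₀) := by
  obtain ⟨hC, hT, hA, hM⟩ := h
  refine ⟨hC.comp contDiff_neg,
    hT.comp (Homeomorph.neg ℝ).isClosedEmbedding.tendsto_cocompact, ?_, ?_⟩
  · intro x hx y hy hxy
    exact hM (mem_Ici.2 (le_neg.1 hy)) (mem_Ici.2 (le_neg.1 hx)) (neg_le_neg hxy)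
  · intro x hx y hy hxy
    exact hA (mem_Iic.2 (neg_le.1 hy)) (mem_Iic.2 (neg_le.1 hx)) (neg_le_neg hxy)

theorem A1cond.monotone_Hp {H : ℝ → ℝ} {p₀ : ℝ} (h : A1cond H p₀) : Monotone (Hp H p₀) := by
  intro x y hxy
  simp only [Hp_eq_max]
  exact h.2.2.2 (mem_Ici.2 (le_max_right _ _)) (mem_Ici.2 (le_max_right _ _)) (max_le_max_right _ hxy)

theorem A1cond.le_Hp {H : ℝ → ℝ} {p₀ : ℝ} (h : A1cond H p₀) (p : ℝ) : H p₀ ≤ Hp H p₀ p := by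
  rw [Hp_eq_max]
  exact h.2.2.2 self_mem_Ici (mem_Ici.2 (le_max_right _ _)) (le_max_right _ _)

theorem A1cond.le_Hm {H : ℝ → ℝ} {p₀ : ℝ} (h : A1cond H p₀) (p : ℝ) : H p₀ ≤ Hm H p₀ p := by
  have := h.neg.le_Hp (-p)
  rwa [← Hm_neg_eq_Hp, neg_neg, neg_neg] at this

/-- The last point where the non-decreasing envelope takes a value `c` in its range. -/
theorem A1cond.isGreatest_sSup {H : ℝ → ℝ} {p₀ c : ℝ} (h : A1cond H p₀) (hc : H p₀ ≤ c) :
    IsGreatest {p : ℝ | Hp H p₀ p ≤ c} (sSup {p : ℝ | Hp H p₀ p = c}) ∧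
      Hp H p₀ (sSup {p : ℝ | Hp H p₀ p = c}) = c := by
  have hcont : Continuous (Hp H p₀) := by
    rw [funext (Hp_eq_max H p₀)]
    exact h.1.continuous.comp (continuous_id.max continuous_const)
  have hlim : Tendsto H atTop atTop := h.2.1.mono_left atTop_le_cocompact
  obtain ⟨R, hR⟩ := ((hlim.eventually_gt_atTop c).and (eventually_ge_atTop p₀)).exists
  have hpR : c < Hp H p₀ R := by rw [Hp_eq_max, max_eq_left hR.2]; exact hR.1
  have hp0 : Hp H p₀ p₀ = H p₀ := by rw [Hp_eq_max, max_self]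
  have hne : {p : ℝ | Hp H p₀ p = c}.Nonempty := by
    obtain ⟨p, -, hp⟩ := intermediate_value_Icc hR.2 hcont.continuousOn
      (show c ∈ Icc (Hp H p₀ p₀) (Hp H p₀ R) from ⟨by rwa [hp0], hpR.le⟩)
    exact ⟨p, hp⟩
  have hbdd : BddAbove {p : ℝ | Hp H p₀ p = c} := by
    refine ⟨R, fun p hp => le_of_not_gt fun hlt => ?_⟩
    exact absurd (h.monotone_Hp hlt.le) (not_le.2 (hp.trans_lt hpR))
  have hmem : Hp H p₀ (sSup {p : ℝ | Hp H p₀ p = c}) = c :=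
    (isClosed_eq hcont continuous_const).csSup_mem hne hbdd
  refine ⟨⟨hmem.le, fun p hp => le_of_not_gt fun hlt => ?_⟩, hmem⟩
  exact hlt.not_ge (le_csSup hbdd (le_antisymm hp (hmem.ge.trans (h.monotone_Hp hlt.le))))

/-- `G` grows at rate at most `L` as long as either its value or the corresponding linear
bound stays below the level `c`. -/
def GrowthBelow (G : ℝ → ℝ) (c L : ℝ) : Prop :=
  ∀ x y d : ℝ, 0 ≤ d → y ≤ x + d → (G y ≤ c ∨ G x + L * d ≤ c) → G y ≤ G x + L * d

theorem growthBelow_Hp {H : ℝ → ℝ} {p₀ c L : ℝ} (h : A1cond H p₀) (hc : H p₀ ≤ c) (hL : 0 < L)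
    (hd : ∀ p ∈ Icc p₀ (sSup {p : ℝ | Hp H p₀ p = c}), |deriv H p| ≤ L) :
    GrowthBelow (Hp H p₀) c L := by
  obtain ⟨hgr, hb⟩ := h.isGreatest_sSup hc
  generalize sSup {p : ℝ | Hp H p₀ p = c} = b at *
  have hp0b : p₀ ≤ b := hgr.2 (show Hp H p₀ p₀ ≤ c by rwa [Hp_eq_max, max_self])
  have lip : ∀ x y, x ≤ y → y ≤ b → Hp H p₀ y ≤ Hp H p₀ x + L * (y - x) := by
    intro x y hxy hy
    simp only [Hp_eq_max]
    have hdiff := h.1.differentiable one_ne_zero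
    have key := (convex_Icc p₀ b).norm_image_sub_le_of_norm_deriv_le
      (fun p _ => hdiff p) hd
      (⟨le_max_right _ _, max_le (hxy.trans hy) hp0b⟩ : max x p₀ ∈ Icc p₀ b)
      (⟨le_max_right _ _, max_le hy hp0b⟩ : max y p₀ ∈ Icc p₀ b)
    have habs : |max y p₀ - max x p₀| ≤ y - x :=
      (abs_max_sub_max_le_abs y x p₀).trans_eq (abs_of_nonneg (sub_nonneg.2 hxy))
    have h1 := (le_abs_self _).trans (key.trans (mul_le_mul_of_nonneg_left habs hL.le))
    linarith
  intro x y d hd0 hyd hor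
  rcases le_total y x with hyx | hxy
  · exact (h.monotone_Hp hyx).trans (le_add_of_nonneg_right (mul_nonneg hL.le hd0))
  have hmul : ∀ t, t ≤ x + d → L * (t - x) ≤ L * d := fun t ht =>
    mul_le_mul_of_nonneg_left (by linarith) hL.le
  rcases le_or_gt y b with hy | hy
  · linarith [lip x y hxy hy, hmul y hyd]
  · rcases hor with hor | hor
    · exact absurd (hgr.2 hor) (not_le.2 hy)
    · have hxb : x ≤ b := hgr.2
        ((le_add_of_nonneg_right (mul_nonneg hL.le hd0)).trans hor : Hp H p₀ x ≤ c)
      have hlt : L * (b - x) < L * d := mul_lt_mul_of_pos_left (by linarith) hL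
      linarith [lip x b hxb le_rfl]

theorem sSup_Hp_neg (H : ℝ → ℝ) (p₀ c : ℝ) :
    sSup {p : ℝ | Hp (fun x => H (-x)) (-p₀) p = c} = -sInf {p : ℝ | Hm H p₀ p = c} := by
  rw [Real.sInf_def, neg_neg]
  congr 1
  ext p
  simp [← Hm_neg_eq_Hp]

section Stencil

variable {K : Type*} {G : K → ℝ → ℝ} {c L m Δx Δt u v w : ℝ} {a b : K → ℝ}

/-- If the first time increment at a node and at its neighbours is at least `m`, so is the next
time increment at the node. -/
theorem le_increment_of_stencil (hG : ∀ k, GrowthBelow (G k) c (Δx / Δt)) (hΔx : 0 < Δx)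
    (hΔt : 0 < Δt) (huv : ∀ k, G k ((u - a k) / Δx) ≤ -((v - u) / Δt))
    (hvw : IsLUB (range fun k => G k ((v - b k) / Δx)) (-((w - v) / Δt)))
    (hcm : -c ≤ m) (hm : m ≤ (v - u) / Δt) (hmk : ∀ k, m ≤ (b k - a k) / Δt) :
    m ≤ (w - v) / Δt := by
  suffices -((w - v) / Δt) ≤ -m by linarith
  refine hvw.2 ?_
  rintro _ ⟨k, rfl⟩
  have hd : 0 ≤ (v - u - m * Δt) / Δx :=
    div_nonneg (sub_nonneg.2 ((le_div_iff₀ hΔt).1 hm)) hΔx.le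
  have hLd : Δx / Δt * ((v - u - m * Δt) / Δx) = (v - u) / Δt - m := by field_simp
  have hle : (v - b k) / Δx ≤ (u - a k) / Δx + (v - u - m * Δt) / Δx := by
    rw [← add_div]
    exact div_le_div_of_nonneg_right (by linarith [(le_div_iff₀ hΔt).1 (hmk k)]) hΔx.le
  have := hG k _ _ _ hd hle (Or.inr (by rw [hLd]; linarith [huv k]))
  rw [hLd] at this
  show G k ((v - b k) / Δx) ≤ -m
  linarith [huv k]

/-- If the first time increment at a node and at its neighbours is at most `m`, so is the next
time increment at the node. -/
theorem increment_le_of_stencil (hG : ∀ k, GrowthBelow (G k) c (Δx / Δt)) (hΔx : 0 < Δx)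
    (hΔt : 0 < Δt) (huv : IsLUB (range fun k => G k ((u - a k) / Δx)) (-((v - u) / Δt)))
    (hvw : ∀ k, G k ((v - b k) / Δx) ≤ -((w - v) / Δt))
    (hc : -c ≤ (v - u) / Δt) (hm : (v - u) / Δt ≤ m) (hmk : ∀ k, (b k - a k) / Δt ≤ m) :
    (w - v) / Δt ≤ m := by
  suffices -((v - u) / Δt) ≤ -((w - v) / Δt) + (m - (v - u) / Δt) by linarith
  refine huv.2 ?_
  rintro _ ⟨k, rfl⟩
  have hd : 0 ≤ (m * Δt - (v - u)) / Δx :=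
    div_nonneg (sub_nonneg.2 ((div_le_iff₀ hΔt).1 hm)) hΔx.le
  have hLd : Δx / Δt * ((m * Δt - (v - u)) / Δx) = m - (v - u) / Δt := by field_simp
  have hle : (u - a k) / Δx ≤ (v - b k) / Δx + (m * Δt - (v - u)) / Δx := by
    rw [← add_div]
    exact div_le_div_of_nonneg_right (by linarith [(div_le_iff₀ hΔt).1 (hmk k)]) hΔx.le
  have hGc : G k ((u - a k) / Δx) ≤ c := (huv.1 ⟨k, rfl⟩).trans (by linarith)
  have := hG k _ _ _ hd hle (Or.inl hGc)
  rw [hLd] at this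
  show G k ((u - a k) / Δx) ≤ _
  linarith [hvw k]

end Stencil

section Scheme

variable {N : ℕ} {H : Fin N → ℝ → ℝ} {p₀ : Fin N → ℝ} {Δx Δt : ℝ} {U : Fin N → ℕ → ℕ → ℝ}

/-- At interior nodes the numerical flux is the maximum of the left and right fluxes. -/
theorem SchemeNS.flux_succ (hU : SchemeNS H p₀ Δx Δt U) (hΔt : 0 < Δt) (n : ℕ) (α : Fin N)
    (i : ℕ) : -((U α (n + 1) (i + 1) - U α n (i + 1)) / Δt) =
      max (Hp (H α) (p₀ α) ((U α n (i + 1) - U α n i) / Δx))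
        (Hm (H α) (p₀ α) ((U α n (i + 2) - U α n (i + 1)) / Δx)) := by
  have h := (hU n).1 α (i + 1) (Nat.le_add_left 1 i)
  simp only [Nat.add_sub_cancel] at h
  rw [h]
  field_simp
  ring

/-- At the junction the numerical flux is the maximum over all branches of the right fluxes. -/
theorem SchemeNS.isLUB_flux_zero (hU : SchemeNS H p₀ Δx Δt U) (hΔt : 0 < Δt) (n : ℕ)
    (α : Fin N) :
    IsLUB (range fun β => Hm (H β) (p₀ β) ((U β n 1 - U α n 0) / Δx))
      (-((U α (n + 1) 0 - U α n 0) / Δt)) := by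
  have hcommon : ∀ β, U β n 0 = U α n 0 := fun β => (hU n).2.1 β α
  have h := (hU n).2.2 α
  simp only [hcommon] at h
  have hval : -((U α (n + 1) 0 - U α n 0) / Δt) =
      sSup (range fun β => Hm (H β) (p₀ β) ((U β n 1 - U α n 0) / Δx)) := by
    rw [h]
    field_simp
    ring
  rw [hval]
  exact isLUB_csSup ⟨_, ⟨α, rfl⟩⟩ (finite_range _).bddAbove

/-- Every node sees its neighbours through a family of flux functions, each inheriting the growth
bounds common to the envelopes. -/
theorem SchemeNS.exists_stencil (hU : SchemeNS H p₀ Δx Δt U) (hΔt : 0 < Δt) {c L : ℝ}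
    (hp : ∀ α, GrowthBelow (Hp (H α) (p₀ α)) c L)
    (hm : ∀ α, GrowthBelow (fun p => Hm (H α) (p₀ α) (-p)) c L) (α : Fin N) (i : ℕ) :
    ∃ (K : Type) (G : K → ℝ → ℝ) (nbr : K → Fin N × ℕ), (∀ k, GrowthBelow (G k) c L) ∧
      ∀ n, IsLUB (range fun k => G k ((U α n i - U (nbr k).1 n (nbr k).2) / Δx))
        (-((U α (n + 1) i - U α n i) / Δt)) := by
  have hneg : ∀ x y : ℝ, -((x - y) / Δx) = (y - x) / Δx := fun x y => by
    rw [← neg_div, neg_sub]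
  cases i with
  | zero =>
    refine ⟨Fin N, fun β p => Hm (H β) (p₀ β) (-p), fun β => (β, 1), hm, fun n => ?_⟩
    simpa only [hneg] using hU.isLUB_flux_zero hΔt n α
  | succ i =>
    refine ⟨Bool, fun k => bif k then Hp (H α) (p₀ α) else fun p => Hm (H α) (p₀ α) (-p),
      fun k => bif k then (α, i) else (α, i + 2), ?_, fun n => ?_⟩
    · rintro (_ | _)
      exacts [hm α, hp α]
    · rw [hU.flux_succ hΔt, max_comm]
      simpa [Bool.range_eq, hneg] using isLUB_pair

theorem SchemeNS.increment_le (hU : SchemeNS H p₀ Δx Δt U) (hΔt : 0 < Δt)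
    (hA1 : ∀ α, A1cond (H α) (p₀ α)) (n : ℕ) (α : Fin N) (i : ℕ) :
    (U α (n + 1) i - U α n i) / Δt ≤ -H α (p₀ α) := by
  suffices H α (p₀ α) ≤ -((U α (n + 1) i - U α n i) / Δt) by linarith
  cases i with
  | zero => exact ((hA1 α).le_Hm _).trans ((hU.isLUB_flux_zero hΔt n α).1 ⟨α, rfl⟩)
  | succ i =>
    rw [hU.flux_succ hΔt]
    exact ((hA1 α).le_Hp _).trans (le_max_left _ _)

end Scheme

/-- **Time derivative estimate for the scheme** (Theorem 2.3 (ii)).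
Assume (A1) and that `m⁰ = inf_{β,i} W^{β,0}_i` is finite (encoded by `IsGLB`).
If `U` solves the scheme (NS) and the CFL condition (CFL′) holds, then with
`mS n = inf_{α,i} W^{α,n}_i` and `MS n = sup_{α,i} W^{α,n}_i`, one has for every `n ≥ 0`:
`m⁰ ≤ mS n ≤ mS (n+1) ≤ MS (n+1) ≤ MS n ≤ MS 0`. -/
theorem time_derivative_estimate_scheme {N : ℕ} (hN : 1 ≤ N)
    (H : Fin N → ℝ → ℝ) (p₀ : Fin N → ℝ)
    (hA1 : ∀ α, A1cond (H α) (p₀ α))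
    (Δx Δt : ℝ) (hΔx : 0 < Δx) (hΔt : 0 < Δt)
    (U : Fin N → ℕ → ℕ → ℝ)
    (hU : SchemeNS H p₀ Δx Δt U)
    (m0 : ℝ)
    (hm0 : IsGLB (Set.range fun q : Fin N × ℕ => (U q.1 1 q.2 - U q.1 0 q.2) / Δt) m0)
    (plow pbar : Fin N → ℝ)
    (hplow : ∀ α, plow α = sInf {p : ℝ | Hm (H α) (p₀ α) p = -m0})
    (hpbar : ∀ α, pbar α = sSup {p : ℝ | Hp (H α) (p₀ α) p = -m0})
    (hCFL : ∀ α : Fin N, ∀ p ∈ Icc (plow α) (pbar α), |deriv (H α) p| ≤ Δx / Δt)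
    (mS MS : ℕ → ℝ)
    (hmS : ∀ n, mS n =
      sInf (Set.range fun q : Fin N × ℕ => (U q.1 (n + 1) q.2 - U q.1 n q.2) / Δt))
    (hMS : ∀ n, MS n =
      sSup (Set.range fun q : Fin N × ℕ => (U q.1 (n + 1) q.2 - U q.1 n q.2) / Δt)) :
    ∀ n : ℕ, m0 ≤ mS n ∧ mS n ≤ mS (n + 1) ∧ mS (n + 1) ≤ MS (n + 1) ∧
      MS (n + 1) ≤ MS n ∧ MS n ≤ MS 0 := by
  have hL : 0 < Δx / Δt := div_pos hΔx hΔt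
  have hlow0 : ∀ α i, m0 ≤ (U α 1 i - U α 0 i) / Δt := fun α i => hm0.1 ⟨(α, i), rfl⟩
  have hmin : ∀ α, H α (p₀ α) ≤ -m0 := fun α => by
    linarith [hlow0 α 0, hU.increment_le hΔt hA1 0 α 0]
  have hlowbar : ∀ α, plow α ≤ p₀ α ∧ p₀ α ≤ pbar α := fun α => by
    constructor
    · have := ((hA1 α).neg.isGreatest_sSup (c := -m0) (by simpa using hmin α)).1.2
        (show Hp _ _ (-p₀ α) ≤ _ by simpa [Hp_eq_max] using hmin α)
      rw [sSup_Hp_neg, ← hplow] at this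
      exact neg_le_neg_iff.1 this
    · rw [hpbar]
      exact ((hA1 α).isGreatest_sSup (hmin α)).1.2
        (show Hp _ _ (p₀ α) ≤ _ by simpa [Hp_eq_max] using hmin α)
  have hgp : ∀ α, GrowthBelow (Hp (H α) (p₀ α)) (-m0) (Δx / Δt) := fun α =>
    growthBelow_Hp (hA1 α) (hmin α) hL fun p hp =>
      hCFL α p ⟨(hlowbar α).1.trans hp.1, by rw [hpbar]; exact hp.2⟩
  have hgm : ∀ α, GrowthBelow (fun p => Hm (H α) (p₀ α) (-p)) (-m0) (Δx / Δt) := fun α => by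
    rw [funext (Hm_neg_eq_Hp (H α) (p₀ α))]
    refine growthBelow_Hp (hA1 α).neg (by simpa using hmin α) hL fun p hp => ?_
    rw [sSup_Hp_neg, ← hplow] at hp
    rw [deriv_comp_neg, abs_neg]
    exact hCFL α (-p) ⟨le_neg.1 hp.2, (neg_le.1 hp.1).trans (hlowbar α).2⟩
  have hstepLow : ∀ n m, m0 ≤ m → (∀ α i, m ≤ (U α (n + 1) i - U α n i) / Δt) →
      ∀ α i, m ≤ (U α (n + 2) i - U α (n + 1) i) / Δt := fun n m hm hW α i => by
    obtain ⟨K, G, nbr, hG, hF⟩ := hU.exists_stencil hΔt hgp hgm α i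
    exact le_increment_of_stencil hG hΔx hΔt (fun k => (hF n).1 ⟨k, rfl⟩) (hF (n + 1))
      (by rwa [neg_neg]) (hW α i) fun k => hW _ _
  have hlow : ∀ n α i, m0 ≤ (U α (n + 1) i - U α n i) / Δt := fun n => by
    induction n with
    | zero => exact hlow0
    | succ n ih => exact hstepLow n m0 le_rfl ih
  have hstepUp : ∀ n M, (∀ α i, (U α (n + 1) i - U α n i) / Δt ≤ M) →
      ∀ α i, (U α (n + 2) i - U α (n + 1) i) / Δt ≤ M := fun n M hW α i => by
    obtain ⟨K, G, nbr, hG, hF⟩ := hU.exists_stencil hΔt hgp hgm α i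
    exact increment_le_of_stencil hG hΔx hΔt (hF n) (fun k => (hF (n + 1)).1 ⟨k, rfl⟩)
      (by rw [neg_neg]; exact hlow n α i) (hW α i) fun k => hW _ _
  have : Nonempty (Fin N × ℕ) := ⟨(⟨0, hN⟩, 0)⟩
  have hmSle : ∀ n α i, mS n ≤ (U α (n + 1) i - U α n i) / Δt := fun n α i => by
    rw [hmS]
    exact csInf_le ⟨m0, by rintro _ ⟨q, rfl⟩; exact hlow n q.1 q.2⟩ ⟨(α, i), rfl⟩
  have hleMS : ∀ n α i, (U α (n + 1) i - U α n i) / Δt ≤ MS n := fun n α i => by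
    obtain ⟨B, hB⟩ := (finite_range fun α => -H α (p₀ α)).bddAbove
    rw [hMS]
    refine le_csSup ⟨B, ?_⟩ ⟨(α, i), rfl⟩
    rintro _ ⟨q, rfl⟩
    exact (hU.increment_le hΔt hA1 n q.1 q.2).trans (hB ⟨q.1, rfl⟩)
  have hge : ∀ n m, (∀ α i, m ≤ (U α (n + 1) i - U α n i) / Δt) → m ≤ mS n := fun n m h => by
    rw [hmS]
    exact le_csInf (range_nonempty _) (by rintro _ ⟨q, rfl⟩; exact h q.1 q.2)
  have hle : ∀ n M, (∀ α i, (U α (n + 1) i - U α n i) / Δt ≤ M) → MS n ≤ M := fun n M h => by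
    rw [hMS]
    exact csSup_le (range_nonempty _) (by rintro _ ⟨q, rfl⟩; exact h q.1 q.2)
  have hanti : Antitone MS := antitone_nat_of_succ_le fun n =>
    hle (n + 1) _ (hstepUp n _ (hleMS n))
  intro n
  have hm : m0 ≤ mS n := hge n m0 (hlow n)
  exact ⟨hm, hge (n + 1) _ (hstepLow n _ hm (hmSle n)),
    (hmSle (n + 1) ⟨0, hN⟩ 0).trans (hleMS (n + 1) ⟨0, hN⟩ 0),
    hanti n.le_succ, hanti n.zero_le⟩
end

section
/- (Gradient estimate from a lower bound on the discrete time derivative) Assume (A1). Fix n ∈ ℕ, let (U^{α,n}_i) be given and let (U^{α,n+1}_i) be computed from it by the scheme (NS). If there is a constant K ∈ ℝ such that K ≤ W^{α,n}_i for all i ≥ 0 and α = 1,…,N, then for all i ≥ 0 and α = 1,…,N: inf{p ∈ ℝ : H⁻_α(p) = −K} ≤ p^{α,n}_{i,+} ≤ sup{p ∈ ℝ : H⁺_α(p) = −K}. -/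
open Set Filter

theorem Hm_eq_comp_min (H : ℝ → ℝ) (p₀ : ℝ) : Hm H p₀ = fun p => H (min p p₀) := by
  funext p
  unfold Hm
  split_ifs with h
  · rw [min_eq_left h]
  · rw [min_eq_right (not_le.mp h).le]

theorem Hp_eq_comp_max (H : ℝ → ℝ) (p₀ : ℝ) : Hp H p₀ = fun p => H (max p p₀) := by
  funext p
  unfold Hp
  split_ifs with h
  · rw [max_eq_right h]
  · rw [max_eq_left (not_le.mp h).le]

namespace A1cond

variable {H : ℝ → ℝ} {p₀ : ℝ}

theorem continuous_Hm (h : A1cond H p₀) : Continuous (Hm H p₀) := by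
  rw [Hm_eq_comp_min]
  exact h.1.continuous.comp (continuous_id.min continuous_const)

theorem continuous_Hp (h : A1cond H p₀) : Continuous (Hp H p₀) := by
  rw [Hp_eq_comp_max]
  exact h.1.continuous.comp (continuous_id.max continuous_const)

theorem tendsto_Hm_atBot (h : A1cond H p₀) : Tendsto (Hm H p₀) atBot atTop := by
  refine (h.2.1.mono_left atBot_le_cocompact).congr' ?_
  filter_upwards [eventually_le_atBot p₀] with p hp
  simp [Hm, hp]

theorem tendsto_Hp_atTop (h : A1cond H p₀) : Tendsto (Hp H p₀) atTop atTop := by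
  refine (h.2.1.mono_left atTop_le_cocompact).congr' ?_
  filter_upwards [eventually_gt_atTop p₀] with p hp
  simp [Hp, hp.not_ge]

end A1cond

/-- A continuous function tending to `+∞` at `-∞` attains every level above `f p` to the left
of `p`. -/
theorem sInf_level_le {f : ℝ → ℝ} (hf : Continuous f) (hlim : Tendsto f atBot atTop)
    {p c : ℝ} (hp : f p ≤ c) : sInf {q | f q = c} ≤ p := by
  obtain ⟨a, ha⟩ := eventually_atBot.mp (hlim.eventually_gt_atTop c)
  have hbdd : BddBelow {q | f q = c} :=
    ⟨a, fun q hq => le_of_not_ge fun hqa => (ha q hqa).ne' hq⟩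
  have hap : a ≤ p := le_of_not_ge fun h => (ha p h).not_ge hp
  obtain ⟨q, hq, hqc⟩ := intermediate_value_Icc' hap hf.continuousOn ⟨hp, (ha a le_rfl).le⟩
  exact (csInf_le hbdd hqc).trans hq.2

/-- A continuous function tending to `+∞` at `+∞` attains every level above `f p` to the right
of `p`. -/
theorem le_sSup_level {f : ℝ → ℝ} (hf : Continuous f) (hlim : Tendsto f atTop atTop)
    {p c : ℝ} (hp : f p ≤ c) : p ≤ sSup {q | f q = c} := by
  obtain ⟨a, ha⟩ := eventually_atTop.mp (hlim.eventually_gt_atTop c)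
  have hbdd : BddAbove {q | f q = c} :=
    ⟨a, fun q hq => le_of_not_ge fun hqa => (ha q hqa).ne' hq⟩
  have hpa : p ≤ a := le_of_not_ge fun h => (ha p h).not_ge hp
  obtain ⟨q, hq, hqc⟩ := intermediate_value_Icc hpa hf.continuousOn ⟨hp, (ha a le_rfl).le⟩
  exact hq.1.trans (le_csSup hbdd hqc)

/-- If an explicit update `v = u - Δt * m` has discrete time derivative at least `K`, then
`m ≤ -K`. -/
theorem le_neg_of_le_update_div {u v m K Δt : ℝ} (hΔt : 0 < Δt) (hv : v = u - Δt * m)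
    (hK : K ≤ (v - u) / Δt) : m ≤ -K := by
  have h : (v - u) / Δt = -m := by
    rw [hv]
    field_simp
    ring
  linarith

/-- **Gradient estimate from a lower bound on the discrete time derivative** (Lemma 2.2).
Assume (A1). Let `Un1` be computed from `Un` by the scheme (NS). If `K ≤ W^{α,n}_i` for
all `i` and `α`, then `inf{p | H⁻_α(p) = -K} ≤ p^{α,n}_{i,+} ≤ sup{p | H⁺_α(p) = -K}`. -/
theorem gradient_estimate_from_time_derivative {N : ℕ} (hN : 1 ≤ N)
    (H : Fin N → ℝ → ℝ) (p₀ : Fin N → ℝ)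
    (hA1 : ∀ α, A1cond (H α) (p₀ α))
    (Δx Δt : ℝ) (hΔx : 0 < Δx) (hΔt : 0 < Δt)
    (Un Un1 : Fin N → ℕ → ℝ)
    (hstep : SchemeStep H p₀ Δx Δt Un Un1)
    (K : ℝ)
    (hK : ∀ (α : Fin N) (i : ℕ), K ≤ (Un1 α i - Un α i) / Δt) :
    ∀ (α : Fin N) (i : ℕ),
      sInf {p : ℝ | Hm (H α) (p₀ α) p = -K} ≤ (Un α (i + 1) - Un α i) / Δx ∧
      (Un α (i + 1) - Un α i) / Δx ≤ sSup {p : ℝ | Hp (H α) (p₀ α) p = -K} := by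
  obtain ⟨hint, -, hzero⟩ := hstep
  intro α i
  have hmax : ∀ j, 1 ≤ j → max (Hp (H α) (p₀ α) ((Un α j - Un α (j - 1)) / Δx))
      (Hm (H α) (p₀ α) ((Un α (j + 1) - Un α j) / Δx)) ≤ -K := fun j hj =>
    le_neg_of_le_update_div hΔt (hint α j hj) (hK α j)
  constructor
  · refine sInf_level_le (hA1 α).continuous_Hm (hA1 α).tendsto_Hm_atBot ?_
    rcases Nat.eq_zero_or_pos i with rfl | hi
    · exact (le_csSup (finite_range _).bddAbove (mem_range_self α)).trans
        (le_neg_of_le_update_div hΔt (hzero α) (hK α 0))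
    · exact (le_max_right _ _).trans (hmax i hi)
  · exact le_sSup_level (hA1 α).continuous_Hp (hA1 α).tendsto_Hp_atTop
      ((le_max_left _ _).trans (hmax (i + 1) (Nat.le_add_left 1 i)))
end
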